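/- Under the standing assumptions, assume further x ≤ 80. Then x₁·φ(z·d₁)/z < ∏_{p} (1 + 1/(p − 1)), where the product (taken in the real numbers) runs over the odd primes p with p ∤ x₁·y₁, ℓ_p ∣ m and ℓ_p > 1. -/

import Mathlib

/-- `ellp a b p` is the least positive integer `ℓ` such that `p ∣ a ^ ℓ - b ^ ℓ`
(and `0` if no such integer exists). -/
noncomputable def ellp (a b p : ℕ) : ℕ := sInf {ℓ : ℕ | 0 < ℓ ∧ p ∣ a ^ ℓ - b ^ ℓ}

open Finset in
/-- The homogeneous geometric sum. -/
def gsum (x y k : ℕ) : ℕ := ∑ i ∈ range k, x ^ i * y ^ (k - 1 - i)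

lemma gsum_mul {x y : ℕ} (h : y ≤ x) (k : ℕ) : gsum x y k * (x - y) = x ^ k - y ^ k :=
  geom_sum₂_mul_of_ge h k

lemma gsum_div {x y : ℕ} (h : y < x) (k : ℕ) : (x ^ k - y ^ k) / (x - y) = gsum x y k := by
  rw [← gsum_mul h.le]
  exact Nat.mul_div_cancel _ (by omega)

lemma gsum_cast {x y p : ℕ} (h : ((x : ℕ) : ZMod p) = y) (k : ℕ) :
    ((gsum x y k : ℕ) : ZMod p) = k * (x : ZMod p) ^ (k - 1) := by
  unfold gsum
  push_cast
  rw [← h]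
  exact geom_sum₂_self _ _

lemma cast_eq_of_dvd {x y p : ℕ} (hxy : y ≤ x) (h : p ∣ x - y) : ((x : ℕ) : ZMod p) = y := by
  have := (ZMod.natCast_eq_zero_iff (x - y) p).2 h
  rw [Nat.cast_sub hxy] at this
  exact sub_eq_zero.1 this

lemma dvd_of_dvd_gsum {x y p k : ℕ} (hp : p.Prime) (hxy : y ≤ x) (h : p ∣ x - y) (hpx : ¬ p ∣ x)
    (hA : p ∣ gsum x y k) : p ∣ k := by
  have := Fact.mk hp
  have h1 := (ZMod.natCast_eq_zero_iff _ _).2 hA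
  rw [gsum_cast (cast_eq_of_dvd hxy h)] at h1
  rcases mul_eq_zero.1 h1 with h2 | h2
  · exact (ZMod.natCast_eq_zero_iff _ _).1 h2
  · exact absurd ((ZMod.natCast_eq_zero_iff _ _).1 (by by_contra h0; exact pow_ne_zero _ h0 h2)) hpx

lemma gsum_dvd {x y k m : ℕ} (hxy : y < x) (h : k ∣ m) : gsum x y k ∣ gsum x y m := by
  have hpos : 0 < x - y := by omega
  apply Nat.dvd_of_mul_dvd_mul_right hpos
  rw [gsum_mul hxy.le, gsum_mul hxy.le]
  obtain ⟨c, rfl⟩ := h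
  rw [pow_mul, pow_mul]
  exact Nat.sub_dvd_pow_sub_pow _ _ c

lemma lt_gsum {x y k : ℕ} (hy : 0 < y) (hxy : y < x) (hk : 2 ≤ k) : k < gsum x y k := by
  unfold gsum
  calc k = ∑ i ∈ Finset.range k, 1 := by simp
    _ < _ := by
      apply Finset.sum_lt_sum
      · intro i _
        have : 0 < x := by omega
        exact Nat.succ_le_of_lt (by positivity)
      · refine ⟨k - 1, by simp; omega, ?_⟩
        simp only [Nat.sub_self, pow_zero, mul_one]
        exact Nat.one_lt_pow (by omega) (by omega)

lemma dvd_pow_sub_iff {a b p : ℕ} [hp : Fact p.Prime] (hba : b ≤ a) (hb : ¬ p ∣ b) (l : ℕ) :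
    p ∣ a ^ l - b ^ l ↔ ((a : ZMod p) / b) ^ l = 1 := by
  have hb' : (b : ZMod p) ≠ 0 := fun h => hb ((ZMod.natCast_eq_zero_iff _ _).1 h)
  rw [← ZMod.natCast_eq_zero_iff, Nat.cast_sub (Nat.pow_le_pow_left hba l), div_pow,
    div_eq_one_iff_eq (pow_ne_zero _ hb'), sub_eq_zero]
  push_cast
  rfl

lemma ellp_eq {a b p m : ℕ} [hp : Fact p.Prime] (hba : b ≤ a) (hb : ¬ p ∣ b) (hm : 0 < m)
    (h : p ∣ a ^ m - b ^ m) : ellp a b p = orderOf ((a : ZMod p) / b) := by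
  have h1 := (dvd_pow_sub_iff hba hb m).1 h
  have hpos : 0 < orderOf ((a : ZMod p) / b) :=
    orderOf_pos_iff.2 (isOfFinOrder_iff_pow_eq_one.2 ⟨m, hm, h1⟩)
  unfold ellp
  have hmem : orderOf ((a : ZMod p) / b) ∈ {ℓ : ℕ | 0 < ℓ ∧ p ∣ a ^ ℓ - b ^ ℓ} :=
    ⟨hpos, (dvd_pow_sub_iff hba hb _).2 (pow_orderOf_eq_one _)⟩
  apply le_antisymm
  · exact Nat.sInf_le hmem
  · have h2 := Nat.sInf_mem ⟨_, hmem⟩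
    exact orderOf_le_of_pow_eq_one h2.1 ((dvd_pow_sub_iff hba hb _).1 h2.2)

/-- primes dividing the geometric sum and `x` (or `y`) divide `gcd x y`. -/
lemma not_dvd_mul {x y q k : ℕ} (hq : q.Prime) (hxy : y ≤ x) (hg : ¬ q ∣ Nat.gcd x y)
    (hk : 0 < k) (hS : q ∣ gsum x y k) : ¬ q ∣ x * y := by
  have h : q ∣ x ^ k - y ^ k := by rw [← gsum_mul hxy]; exact dvd_mul_of_dvd_left hS _
  have hle := Nat.pow_le_pow_left hxy k
  intro h1
  rcases (Nat.Prime.dvd_mul hq).1 h1 with h1 | h1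
  · have h2 : q ∣ y ^ k := (Nat.dvd_sub_iff_right hle (dvd_pow h1 hk.ne')).1 h
    exact hg (Nat.dvd_gcd h1 (hq.dvd_of_dvd_pow h2))
  · have h2 : q ∣ x ^ k := (Nat.dvd_sub_iff_left hle (dvd_pow h1 hk.ne')).1 h
    exact hg (Nat.dvd_gcd (hq.dvd_of_dvd_pow h2) h1)

/-- a prime dividing both `x - y` and the geometric sum divides the totient of the latter. -/
lemma dvd_totient_gsum {x y p m : ℕ} (hp : p.Prime) (hy : 0 < y) (hxy : y < x) (h : p ∣ x - y)
    (hpx : ¬ p ∣ x) (hco : Nat.gcd x y = 1)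
    (hA : p ∣ gsum x y m) : p ∣ (gsum x y m).totient := by
  have := Fact.mk hp
  have hpm := dvd_of_dvd_gsum hp hxy.le h hpx hA
  refine dvd_trans ?_ (Nat.totient_dvd_of_dvd (gsum_dvd hxy hpm))
  have hpS : p ∣ gsum x y p := by
    rw [← ZMod.natCast_eq_zero_iff, gsum_cast (cast_eq_of_dvd hxy.le h)]
    simp
  obtain ⟨k, hk⟩ := hpS
  have hlt := lt_gsum hy hxy hp.two_le
  have hk1 : k ≠ 1 := by rintro rfl; omega
  by_cases hpk : p ∣ k
  · have : p * p ∣ gsum x y p := by rw [hk]; exact Nat.mul_dvd_mul_left p hpk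
    refine dvd_trans ?_ (Nat.totient_dvd_of_dvd this)
    rw [Nat.totient_mul_of_prime_of_dvd hp dvd_rfl]
    exact dvd_mul_right _ _
  · have hq := Nat.minFac_prime hk1
    set q := k.minFac
    have hqk : q ∣ k := Nat.minFac_dvd k
    have hqS : q ∣ gsum x y p := by rw [hk]; exact dvd_mul_of_dvd_right hqk p
    have hqxy := not_dvd_mul hq hxy.le (by rw [hco]; exact hq.not_dvd_one) hp.pos hqS
    have hqx : ¬ q ∣ x := fun h => hqxy (dvd_mul_of_dvd_left h y)
    have hqy : ¬ q ∣ y := fun h => hqxy (dvd_mul_of_dvd_right h x)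
    refine dvd_trans ?_ (Nat.totient_dvd_of_dvd hqS)
    rw [Nat.totient_prime hq]
    have := Fact.mk hq
    have hpow : q ∣ x ^ p - y ^ p := by
      rw [← gsum_mul hxy.le]; exact dvd_mul_of_dvd_left hqS _
    have hr := (dvd_pow_sub_iff hxy.le hqy p).1 hpow
    have hne : (x : ZMod q) / y ≠ 1 := by
      intro h1
      have h2 : q ∣ x - y := by
        have := (dvd_pow_sub_iff hxy.le hqy 1).2 (by rw [h1, one_pow])
        simpa using this
      have h3 := dvd_of_dvd_gsum hq hxy.le h2 hqx hqS
      rw [Nat.prime_dvd_prime_iff_eq hq hp] at h3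
      exact hpk (h3 ▸ hqk)
    have ho := orderOf_eq_prime hr hne
    rw [← ho]
    apply orderOf_dvd_of_pow_eq_one
    apply ZMod.pow_card_sub_one_eq_one (p := q)
    apply div_ne_zero
    · exact fun h => hqx ((ZMod.natCast_eq_zero_iff _ _).1 h)
    · exact fun h => hqy ((ZMod.natCast_eq_zero_iff _ _).1 h)

/-- Geometric sums after removing the common factor. -/
lemma gsum_scale (d x y m : ℕ) (hm : 0 < m) :
    gsum (d * x) (d * y) m = d ^ (m - 1) * gsum x y m := by
  unfold gsum
  rw [Finset.mul_sum]
  refine Finset.sum_congr rfl fun i hi => ?_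
  have hi' := Finset.mem_range.1 hi
  have : m - 1 = i + (m - 1 - i) := by omega
  rw [mul_pow, mul_pow]
  conv_rhs => rw [this, pow_add]
  have h2 : i + (m - 1 - i) - i = m - 1 - i := by omega
  rw [h2]
  ring

lemma prod_union_bound (s a b : Finset ℕ) (hs : s ⊆ a ∪ b) (f : ℕ → ℝ)
    (h0 : ∀ p ∈ a ∪ b, 0 < f p) (h1 : ∀ p ∈ a ∪ b, f p ≤ 1) :
    (∏ p ∈ a, f p) * ∏ p ∈ b, f p ≤ ∏ p ∈ s, f p := by
  rw [← Finset.prod_union_inter]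
  have h2 : ∏ p ∈ a ∩ b, f p ≤ 1 :=
    Finset.prod_le_one
      (fun p hp => (h0 p (Finset.mem_union_left _ (Finset.mem_inter.1 hp).1)).le)
      (fun p hp => h1 p (Finset.mem_union_left _ (Finset.mem_inter.1 hp).1))
  have h3 : 0 ≤ ∏ p ∈ a ∪ b, f p := Finset.prod_nonneg fun p hp => (h0 p hp).le
  have h4 : ∏ p ∈ a ∪ b, f p ≤ ∏ p ∈ s, f p := by
    rw [← Finset.prod_sdiff hs]
    apply mul_le_of_le_one_left
    · exact Finset.prod_nonneg fun p hp => (h0 p (hs hp)).le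
    · exact Finset.prod_le_one
        (fun p hp => (h0 p (Finset.mem_sdiff.1 hp).1).le)
        (fun p hp => h1 p (Finset.mem_sdiff.1 hp).1)
  nlinarith

lemma totient_real (N : ℕ) :
    (N.totient : ℝ) = N * ∏ p ∈ N.primeFactors, (1 - ((p : ℕ) : ℝ)⁻¹) := by
  have := Nat.totient_eq_mul_prod_factors N
  have h := congrArg (fun q : ℚ => (q : ℝ)) this
  push_cast at h
  exact h

theorem x1_phi_lt_prod (x y z m n : ℕ) (hx : 0 < x) (hy : 0 < y) (hz : 0 < z)
    (hm : 0 < m) (hn : 0 < n) (hxy : y < x) (hzxy : z ≤ x - y)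
    (hgcd : Nat.gcd m n = 1) (hmn : n < m)
    (heq : Nat.totient (z * ((x ^ m - y ^ m) / (x - y))) =
      z * ((x ^ n - y ^ n) / (x - y)))
    (hx80 : x ≤ 80)
    (d₁ x₁ y₁ : ℕ) (hd₁ : d₁ = Nat.gcd x y) (hx₁ : x₁ = x / d₁) (hy₁ : y₁ = y / d₁) :
    (x₁ : ℝ) * (Nat.totient (z * d₁)) / z <
      ∏ p ∈ (Finset.range (x₁ ^ m - y₁ ^ m + 1)).filter
        (fun p => p.Prime ∧ Odd p ∧ ¬ p ∣ x₁ * y₁ ∧ ellp x₁ y₁ p ∣ m ∧ 1 < ellp x₁ y₁ p),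
      (1 + 1 / ((p : ℝ) - 1)) := by
  rw [gsum_div hxy, gsum_div hxy] at heq
  have hd0 : 0 < d₁ := hd₁ ▸ Nat.gcd_pos_of_pos_left _ hx
  have hxd : x = d₁ * x₁ := by
    rw [hx₁, Nat.mul_div_cancel' (hd₁ ▸ Nat.gcd_dvd_left x y)]
  have hyd : y = d₁ * y₁ := by
    rw [hy₁, Nat.mul_div_cancel' (hd₁ ▸ Nat.gcd_dvd_right x y)]
  have hco : Nat.gcd x₁ y₁ = 1 := by
    rw [hx₁, hy₁, hd₁]
    exact Nat.coprime_div_gcd_div_gcd (hd₁ ▸ hd0)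
  have hy1 : 0 < y₁ := Nat.pos_of_ne_zero (by rintro rfl; simp at hyd; omega)
  have hxy1 : y₁ < x₁ := by
    rw [hxd, hyd] at hxy
    exact Nat.lt_of_mul_lt_mul_left hxy
  set A := gsum x y m with hA
  set B := gsum x y n with hB
  have hApos : 0 < A := by
    have := lt_gsum hy hxy (k := m) (by omega)
    omega
  have hA1 : A = d₁ ^ (m - 1) * gsum x₁ y₁ m := by
    rw [hA, hxd, hyd, gsum_scale _ _ _ _ hm]
  have hB1 : B = d₁ ^ (n - 1) * gsum x₁ y₁ n := by
    rw [hB, hxd, hyd, gsum_scale _ _ _ _ hn]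
  set F := (Finset.range (x₁ ^ m - y₁ ^ m + 1)).filter
        (fun p => p.Prime ∧ Odd p ∧ ¬ p ∣ x₁ * y₁ ∧ ellp x₁ y₁ p ∣ m ∧ 1 < ellp x₁ y₁ p) with hF
  -- the set inclusion
  have hsub : (z * A).primeFactors ⊆ (z * d₁).primeFactors ∪ F := by
    intro p hp
    have hpp := Nat.prime_of_mem_primeFactors hp
    have hpd := Nat.dvd_of_mem_primeFactors hp
    by_cases hzd : p ∣ z * d₁
    · exact Finset.mem_union_left _ (Nat.mem_primeFactors.2 ⟨hpp, hzd, by positivity⟩)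
    have hpz : ¬ p ∣ z := fun h => hzd (dvd_mul_of_dvd_left h _)
    have hpd1 : ¬ p ∣ d₁ := fun h => hzd (dvd_mul_of_dvd_right h _)
    have hpA1 : p ∣ gsum x₁ y₁ m := by
      have h1 := (hpp.dvd_mul.1 hpd).resolve_left hpz
      rw [hA1] at h1
      exact (hpp.dvd_mul.1 h1).resolve_left fun h => hpd1 (hpp.dvd_of_dvd_pow h)
    have hpxy := not_dvd_mul hpp hxy1.le (by rw [hco]; exact hpp.not_dvd_one) hm hpA1
    have hpx : ¬ p ∣ x₁ := fun h => hpxy (dvd_mul_of_dvd_left h _)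
    have hpy : ¬ p ∣ y₁ := fun h => hpxy (dvd_mul_of_dvd_right h _)
    have hpow : p ∣ x₁ ^ m - y₁ ^ m := by
      rw [← gsum_mul hxy1.le]; exact dvd_mul_of_dvd_left hpA1 _
    have hnd : ¬ p ∣ x₁ - y₁ := by
      intro h
      have h1 := dvd_totient_gsum hpp hy1 hxy1 h hpx hco hpA1
      have h2 : p ∣ (z * A).totient := by
        refine h1.trans (Nat.totient_dvd_of_dvd ?_)
        rw [hA1]
        exact dvd_mul_of_dvd_right (dvd_mul_left _ _) _
      rw [heq] at h2
      have h3 := (hpp.dvd_mul.1 h2).resolve_left hpz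
      rw [hB1] at h3
      have h4 := (hpp.dvd_mul.1 h3).resolve_left fun h => hpd1 (hpp.dvd_of_dvd_pow h)
      have h5 := dvd_of_dvd_gsum hpp hxy1.le h hpx h4
      have h6 := dvd_of_dvd_gsum hpp hxy1.le h hpx hpA1
      have h7 := Nat.dvd_gcd h6 h5
      rw [hgcd] at h7
      exact hpp.not_dvd_one h7
    have := Fact.mk hpp
    apply Finset.mem_union_right
    rw [hF, Finset.mem_filter, Finset.mem_range]
    have hl := ellp_eq hxy1.le hpy hm hpow
    have hdvd : ellp x₁ y₁ p ∣ m := by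
      rw [hl]
      exact orderOf_dvd_of_pow_eq_one ((dvd_pow_sub_iff hxy1.le hpy m).1 hpow)
    refine ⟨?_, hpp, ?_, hpxy, hdvd, ?_⟩
    · have : y₁ ^ m < x₁ ^ m := Nat.pow_lt_pow_left hxy1 hm.ne'
      exact Nat.lt_succ_of_le (Nat.le_of_dvd (by omega) hpow)
    · rcases hpp.eq_two_or_odd' with h2 | h2
      · subst h2
        omega
      · exact h2
    · have h0 := Nat.pos_of_dvd_of_pos hdvd hm
      rcases Nat.lt_or_ge 1 (ellp x₁ y₁ p) with h1 | h1
      · exact h1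
      · exfalso
        have h1' : ellp x₁ y₁ p = 1 := by omega
        rw [hl, orderOf_eq_one_iff] at h1'
        apply hnd
        have := (dvd_pow_sub_iff (a := x₁) hxy1.le hpy 1).2 (by rw [h1', one_pow])
        simpa using this
  have hprime : ∀ p ∈ (z * d₁).primeFactors ∪ F, p.Prime := by
    intro p hp
    rcases Finset.mem_union.1 hp with h | h
    · exact Nat.prime_of_mem_primeFactors h
    · exact (Finset.mem_filter.1 h).2.1
  have hbound := prod_union_bound _ _ _ hsub (fun p => 1 - ((p : ℕ) : ℝ)⁻¹)
    (fun p hp => by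
      have h : (1 : ℝ) < p := by exact_mod_cast (hprime p hp).one_lt
      have := inv_lt_one_of_one_lt₀ h
      show (0 : ℝ) < 1 - (p : ℝ)⁻¹
      linarith)
    (fun p hp => by
      have : (0 : ℝ) ≤ (p : ℝ)⁻¹ := by positivity
      show 1 - (p : ℝ)⁻¹ ≤ (1 : ℝ)
      linarith)
  have hinv : (∏ p ∈ F, (1 + 1 / ((p : ℝ) - 1))) * ∏ p ∈ F, (1 - ((p : ℕ) : ℝ)⁻¹) = 1 := by
    rw [← Finset.prod_mul_distrib]
    apply Finset.prod_eq_one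
    intro p hp
    have h : (1 : ℝ) < p := by
      exact_mod_cast (hprime p (Finset.mem_union_right _ hp)).one_lt
    have h1 : (p : ℝ) - 1 ≠ 0 := by linarith
    have h2 : (p : ℝ) ≠ 0 := by linarith
    field_simp
    ring
  have hPpos : 0 < ∏ p ∈ F, (1 + 1 / ((p : ℝ) - 1)) := by
    apply Finset.prod_pos
    intro p hp
    have h : (1 : ℝ) < p := by
      exact_mod_cast (hprime p (Finset.mem_union_right _ hp)).one_lt
    have h1 : 0 < (p : ℝ) - 1 := by linarith
    positivity
  -- size comparison
  have hsize : x * B < A := by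
    have hpos : 0 < x - y := by omega
    apply Nat.lt_of_mul_lt_mul_right (a := x - y)
    rw [mul_assoc, gsum_mul hxy.le, gsum_mul hxy.le]
    obtain ⟨k, rfl⟩ : ∃ k, m = n + 1 + k := ⟨m - (n + 1), by omega⟩
    have e1 : y ^ n < x ^ n := Nat.pow_lt_pow_left hxy hn.ne'
    have e2 : y ^ (n + 1 + k) < x ^ (n + 1 + k) := Nat.pow_lt_pow_left hxy (by omega)
    have e3 : y ^ (1 + k) < x ^ (1 + k) := Nat.pow_lt_pow_left hxy (by omega)
    have e4 : x ≤ x ^ (1 + k) := Nat.le_self_pow (by omega) x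
    have e5 : 0 < y ^ n := by positivity
    zify [e1.le, e2.le]
    zify at e1 e2 e3 e4 e5
    have e6 : (x : ℤ) ^ (n + 1 + k) = x ^ n * x ^ (1 + k) := by ring
    have e7 : (y : ℤ) ^ (n + 1 + k) = y ^ n * y ^ (1 + k) := by ring
    rw [e6, e7]
    nlinarith
  have ht1 := totient_real (z * A)
  have ht2 := totient_real (z * d₁)
  rw [heq] at ht1
  push_cast at ht1 ht2
  set P := ∏ p ∈ F, (1 + 1 / ((p : ℝ) - 1))
  set Q := ∏ p ∈ F, (1 - ((p : ℕ) : ℝ)⁻¹)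
  set R := ∏ p ∈ (z * d₁).primeFactors, (1 - ((p : ℕ) : ℝ)⁻¹)
  set T := ∏ p ∈ (z * A).primeFactors, (1 - ((p : ℕ) : ℝ)⁻¹)
  have hz' : (0 : ℝ) < z := by exact_mod_cast hz
  have hA' : (0 : ℝ) < A := by exact_mod_cast hApos
  have hx' : (0 : ℝ) < x := by exact_mod_cast hx
  have hs' : (x : ℝ) * B < A := by exact_mod_cast hsize
  have hxd' : (x : ℝ) = d₁ * x₁ := by exact_mod_cast hxd
  have hBT : (B : ℝ) = A * T := by
    have : (z : ℝ) * B = z * (A * T) := by rw [ht1]; ring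
    exact mul_left_cancel₀ hz'.ne' this
  have hxT : (x : ℝ) * T < 1 := by
    rw [hBT] at hs'
    have : (A : ℝ) * (x * T) < A * 1 := by linarith
    exact lt_of_mul_lt_mul_left this hA'.le
  have hlhs : (x₁ : ℝ) * (Nat.totient (z * d₁)) / z = x * R := by
    rw [ht2, hxd']
    field_simp
  rw [hlhs]
  have hRQ : (x : ℝ) * (R * Q) < 1 := lt_of_le_of_lt (mul_le_mul_of_nonneg_left hbound hx'.le) hxT
  calc (x : ℝ) * R = (x * (R * Q)) * P := by
        have : (x * (R * Q)) * P = x * R * (P * Q) := by ring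
        rw [this, hinv, mul_one]
    _ < 1 * P := mul_lt_mul_of_pos_right hRQ hPpos
    _ = P := one_mul P
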